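/- arXiv:1211.5642 — 2 statements merged into one kernel-verified Lean document; each statement's English description precedes it below -/
import Mathlib

section
/- Let A be a symmetric, essentially nonpositive tensor of order k and dimension n, and suppose λ is the least H-eigenvalue of A (λ is an H-eigenvalue and every H-eigenvalue μ of A satisfies λ ≤ μ). Then λ is the minimum of the set {A x^k : x ∈ ℝ^n, x ≥ 0 componentwise, ∑_{i=1}^n x_i^k = 1}. -/
open Finset

/-- `A x^k = ∑_{i₁,…,i_k} a_{i₁…i_k} x_{i₁}⋯x_{i_k}`. -/
def tApply (k n : ℕ) (A : (Fin k → Fin n) → ℝ) (x : Fin n → ℝ) : ℝ :=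
  ∑ f : Fin k → Fin n, A f * ∏ j : Fin k, x (f j)

/-- The `i`-th component of `A x^{k-1}`:
`∑_{i₂,…,i_k} a_{i i₂…i_k} x_{i₂}⋯x_{i_k}`. -/
def tApplyVec (k n : ℕ) (hk : 2 ≤ k) (A : (Fin k → Fin n) → ℝ) (x : Fin n → ℝ)
    (i : Fin n) : ℝ :=
  ∑ f ∈ Finset.univ.filter (fun f : Fin k → Fin n => f ⟨0, by omega⟩ = i),
    A f * ∏ j ∈ Finset.univ.erase (⟨0, by omega⟩ : Fin k), x (f j)

/-- A tensor is symmetric if its entries are invariant under permutations of the indices. -/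
def IsSymmTensor (k n : ℕ) (A : (Fin k → Fin n) → ℝ) : Prop :=
  ∀ (σ : Equiv.Perm (Fin k)) (f : Fin k → Fin n), A (f ∘ σ) = A f

/-- `lam` is an H-eigenvalue of `A`: there is a real `x ≠ 0` with `A x^{k-1} = lam x^{[k-1]}`. -/
def IsHEigenvalue (k n : ℕ) (hk : 2 ≤ k) (A : (Fin k → Fin n) → ℝ) (lam : ℝ) : Prop :=
  ∃ x : Fin n → ℝ, x ≠ 0 ∧ ∀ i : Fin n, tApplyVec k n hk A x i = lam * x i ^ (k - 1)

/-- The `i`-th row sum `R_i(A) = ∑_{i₂,…,i_k} a_{i i₂…i_k}`. -/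
def rowSum (k n : ℕ) (hk : 2 ≤ k) (A : (Fin k → Fin n) → ℝ) (i : Fin n) : ℝ :=
  ∑ f ∈ Finset.univ.filter (fun f : Fin k → Fin n => f ⟨0, by omega⟩ = i), A f

theorem aux_sum (k n : ℕ) (hk : 2 ≤ k) (A : (Fin k → Fin n) → ℝ) (x : Fin n → ℝ) :
    ∑ i, x i * tApplyVec k n hk A x i = tApply k n A x := by
  unfold tApply tApplyVec
  rw [← Finset.sum_fiberwise (s := Finset.univ)
    (g := fun f : Fin k → Fin n => f ⟨0, by omega⟩)]
  refine Finset.sum_congr rfl fun i _ => ?_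
  rw [Finset.mul_sum]
  refine Finset.sum_congr rfl fun f hf => ?_
  have h0 : f ⟨0, by omega⟩ = i := (Finset.mem_filter.1 hf).2
  rw [← Finset.mul_prod_erase Finset.univ (fun j => x (f j)) (Finset.mem_univ ⟨0, by omega⟩), h0]
  ring

theorem aux_smul (k n : ℕ) (A : (Fin k → Fin n) → ℝ) (x : Fin n → ℝ) (c : ℝ) :
    tApply k n A (fun i => c * x i) = c ^ k * tApply k n A x := by
  unfold tApply
  rw [Finset.mul_sum]
  refine Finset.sum_congr rfl fun f _ => ?_
  rw [Finset.prod_mul_distrib, Finset.prod_const, Finset.card_univ, Fintype.card_fin]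
  ring

theorem aux_homog (k n : ℕ) (hk : 2 ≤ k) (A : (Fin k → Fin n) → ℝ) (m : ℝ)
    (h : ∀ x : Fin n → ℝ, (∀ i, 0 ≤ x i) → ∑ i : Fin n, x i ^ k = 1 → m ≤ tApply k n A x)
    (x : Fin n → ℝ) (hx : ∀ i, 0 ≤ x i) : m * ∑ i, x i ^ k ≤ tApply k n A x := by
  have hs : 0 ≤ ∑ i, x i ^ k := Finset.sum_nonneg fun i _ => pow_nonneg (hx i) k
  rcases hs.eq_or_lt with hs | hs
  · have hz : ∀ i, x i = 0 := by
      intro i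
      have := (Finset.sum_eq_zero_iff_of_nonneg
        (fun i _ => pow_nonneg (hx i) k)).1 hs.symm i (Finset.mem_univ i)
      exact pow_eq_zero_iff (by omega) |>.1 this
    have : tApply k n A x = 0 := by
      unfold tApply
      refine Finset.sum_eq_zero fun f _ => ?_
      rw [Finset.prod_eq_zero (i := (⟨0, by omega⟩ : Fin k)) (Finset.mem_univ _) (hz _), mul_zero]
    rw [this, ← hs, mul_zero]
  · set s := ∑ i, x i ^ k with hsdef
    set c : ℝ := (s⁻¹) ^ ((k : ℝ)⁻¹) with hc
    have hc0 : 0 ≤ c := Real.rpow_nonneg (by positivity) _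
    have hck : c ^ k = s⁻¹ := Real.rpow_inv_natCast_pow (by positivity) (by omega)
    have := h (fun i => c * x i) (fun i => mul_nonneg hc0 (hx i)) (by
      simp only [mul_pow]
      rw [← Finset.mul_sum, hck, ← hsdef]
      exact inv_mul_cancel₀ hs.ne')
    rw [aux_smul, hck] at this
    rw [inv_mul_eq_div, le_div_iff₀ hs] at this
    exact this

theorem aux_symm (k n : ℕ) (hk : 2 ≤ k) (A : (Fin k → Fin n) → ℝ) (hsym : IsSymmTensor k n A)
    (y : Fin n → ℝ) (i : Fin n) (j : Fin k) :
    ∑ f : Fin k → Fin n, A f * ((∏ l ∈ Finset.univ.erase j, y (f l)) * (if f j = i then 1 else 0))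
      = tApplyVec k n hk A y i := by
  unfold tApplyVec
  rw [Finset.sum_filter]
  set z : Fin k := ⟨0, by omega⟩ with hz
  refine Fintype.sum_equiv (Equiv.arrowCongr (Equiv.swap z j) (Equiv.refl _)) _ _ fun f => ?_
  have e : (Equiv.arrowCongr (Equiv.swap z j) (Equiv.refl (Fin n))) f = f ∘ Equiv.swap z j := by
    ext l; simp [Equiv.arrowCongr]
  rw [e, hsym]
  have e2 : (f ∘ Equiv.swap z j) z = f j := by simp
  have e3 : ∏ l ∈ Finset.univ.erase z, y ((f ∘ Equiv.swap z j) l)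
      = ∏ l ∈ Finset.univ.erase j, y (f l) := by
    refine Finset.prod_equiv (Equiv.swap z j) ?_ ?_
    · intro l
      simp only [Finset.mem_erase, Finset.mem_univ, and_true]
      rw [not_iff_not, Equiv.swap_apply_eq_iff, Equiv.swap_apply_right]
    · intro l _; rfl
  rw [e2, e3]
  split_ifs <;> simp

theorem aux_deriv (k n : ℕ) (hk : 2 ≤ k) (A : (Fin k → Fin n) → ℝ) (hsym : IsSymmTensor k n A)
    (y : Fin n → ℝ) (i : Fin n) (m : ℝ) :
    HasDerivAt (fun t : ℝ => tApply k n A (fun l => y l + t * (if l = i then 1 else 0))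
        - m * ∑ l, (y l + t * (if l = i then 1 else 0)) ^ k)
      (k * (tApplyVec k n hk A y i - m * y i ^ (k - 1))) 0 := by
  have hb : ∀ l, HasDerivAt (fun t : ℝ => y l + t * (if l = i then (1:ℝ) else 0))
      (if l = i then 1 else 0) 0 := by
    intro l
    simpa using ((hasDerivAt_id (0:ℝ)).mul_const (if l = i then (1:ℝ) else 0)).const_add (y l)
  have h1 : HasDerivAt (fun t : ℝ => tApply k n A (fun l => y l + t * (if l = i then 1 else 0)))
      (k * tApplyVec k n hk A y i) 0 := by
    unfold tApply
    have := HasDerivAt.fun_sum (u := (Finset.univ : Finset (Fin k → Fin n))) fun f _ =>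
      (HasDerivAt.fun_finsetProd (u := (Finset.univ : Finset (Fin k)))
        fun j _ => hb (f j)).const_mul (A f)
    refine this.congr_deriv ?_
    simp only [zero_mul, add_zero, smul_eq_mul, Finset.mul_sum]
    rw [Finset.sum_comm]
    simp only [aux_symm k n hk A hsym y i]
    simp
  have h2 : HasDerivAt (fun t : ℝ => ∑ l, (y l + t * (if l = i then 1 else 0)) ^ k)
      (k * y i ^ (k - 1)) 0 := by
    have := HasDerivAt.fun_sum (u := (Finset.univ : Finset (Fin n))) fun l _ =>
      (hb l).fun_pow k
    refine this.congr_deriv ?_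
    simp
  refine (h1.sub (h2.const_mul m)).congr_deriv ?_
  ring

theorem aux_eig (k n : ℕ) (hk : 2 ≤ k) (A : (Fin k → Fin n) → ℝ) (hsym : IsSymmTensor k n A)
    (hess : ∀ f : Fin k → Fin n, (¬ ∃ i : Fin n, ∀ j : Fin k, f j = i) → A f ≤ 0)
    (m : ℝ) (h : ∀ x : Fin n → ℝ, (∀ i, 0 ≤ x i) → m * ∑ i, x i ^ k ≤ tApply k n A x)
    (y : Fin n → ℝ) (hy : ∀ i, 0 ≤ y i) (hym : tApply k n A y = m * ∑ i, y i ^ k) (i : Fin n) :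
    tApplyVec k n hk A y i = m * y i ^ (k - 1) := by
  have hd := aux_deriv k n hk A hsym y i m
  have hk0 : (0:ℝ) < k := by exact_mod_cast (by omega : 0 < k)
  set g := (fun t : ℝ => tApply k n A (fun l => y l + t * (if l = i then 1 else 0))
        - m * ∑ l, (y l + t * (if l = i then 1 else 0)) ^ k) with hg
  have g0 : g 0 = 0 := by simp [hg, hym]
  have gnn : ∀ t, -y i ≤ t → 0 ≤ g t := by
    intro t ht
    refine sub_nonneg.2 (h _ fun l => ?_)
    by_cases hl : l = i
    · subst hl; simp; linarith
    · simpa [hl] using hy l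
  rcases (hy i).eq_or_lt with h0 | h0
  · have hle : tApplyVec k n hk A y i ≤ 0 := by
      unfold tApplyVec
      refine Finset.sum_nonpos fun f hf => ?_
      have hf0 : f ⟨0, by omega⟩ = i := (Finset.mem_filter.1 hf).2
      by_cases hc : ∃ i : Fin n, ∀ j : Fin k, f j = i
      · obtain ⟨i', hi'⟩ := hc
        have : i' = i := by rw [← hf0, hi']
        subst this
        rw [Finset.prod_eq_zero (i := (⟨1, by omega⟩ : Fin k)) (by simp)
          (by rw [hi']; exact h0.symm), mul_zero]
      · exact mul_nonpos_of_nonpos_of_nonneg (hess f hc) (Finset.prod_nonneg fun j _ => hy _)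
    have hge : 0 ≤ k * (tApplyVec k n hk A y i - m * y i ^ (k - 1)) := by
      refine ge_of_tendsto hd.tendsto_slope_zero_right ?_
      filter_upwards [self_mem_nhdsWithin] with t ht
      have ht : 0 < t := ht
      rw [zero_add, g0, sub_zero, smul_eq_mul]
      exact mul_nonneg (by positivity) (gnn t (by linarith))
    have hz : y i ^ (k - 1) = 0 := by rw [← h0]; exact zero_pow (by omega)
    rw [hz, mul_zero] at hge ⊢
    rw [sub_zero] at hge
    exact le_antisymm hle (nonneg_of_mul_nonneg_right hge hk0)
  · have hloc : IsLocalMin g 0 := by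
      filter_upwards [Ioi_mem_nhds (show -y i < 0 by linarith)] with t ht
      rw [g0]
      exact gnn t (le_of_lt ht)
    have := hloc.hasDerivAt_eq_zero hd
    have := (mul_eq_zero.1 this).resolve_left hk0.ne'
    linarith

theorem aux_lower (k n : ℕ) (hk : 2 ≤ k) (A : (Fin k → Fin n) → ℝ)
    (hess : ∀ f : Fin k → Fin n, (¬ ∃ i : Fin n, ∀ j : Fin k, f j = i) → A f ≤ 0)
    (lam : ℝ) (x : Fin n → ℝ)
    (hx : ∀ i : Fin n, tApplyVec k n hk A x i = lam * x i ^ (k - 1)) :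
    tApply k n A (fun i => |x i|) ≤ lam * ∑ i, |x i| ^ k := by
  rw [← aux_sum k n hk, Finset.mul_sum]
  refine Finset.sum_le_sum fun i _ => ?_
  obtain ⟨s, hs1, hs⟩ : ∃ s : ℝ, |s| ≤ 1 ∧ s * x i ^ (k - 1) = |x i| ^ (k - 1) := by
    rcases le_total 0 (x i) with h | h
    · exact ⟨1, by simp, by rw [abs_of_nonneg h, one_mul]⟩
    · exact ⟨(-1) ^ (k - 1), by simp, by rw [abs_of_nonpos h, ← mul_pow]; simp⟩
  have key : tApplyVec k n hk A (fun i => |x i|) i ≤ s * tApplyVec k n hk A x i := by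
    unfold tApplyVec
    rw [Finset.mul_sum]
    refine Finset.sum_le_sum fun f hf => ?_
    have hf0 : f ⟨0, by omega⟩ = i := (Finset.mem_filter.1 hf).2
    by_cases hc : ∃ i : Fin n, ∀ j : Fin k, f j = i
    · obtain ⟨i', hi'⟩ := hc
      have : i' = i := by rw [← hf0, hi']
      subst this
      simp only [hi', Finset.prod_const, Finset.card_erase_of_mem (Finset.mem_univ _),
        Finset.card_univ, Fintype.card_fin]
      rw [← hs]
      exact le_of_eq (by ring)
    · rw [← Finset.abs_prod]
      have hA := hess f hc
      set P := ∏ j ∈ Finset.univ.erase (⟨0, by omega⟩ : Fin k), x (f j)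
      have : s * P ≤ |P| := by
        calc s * P ≤ |s * P| := le_abs_self _
          _ = |s| * |P| := abs_mul _ _
          _ ≤ 1 * |P| := by gcongr
          _ = |P| := one_mul _
      have := mul_le_mul_of_nonpos_left this hA
      linarith
  rw [hx i] at key
  have h2 : |x i| ^ k = |x i| * |x i| ^ (k - 1) := by
    rw [← pow_succ']; congr 1; omega
  calc |x i| * tApplyVec k n hk A (fun i => |x i|) i
      ≤ |x i| * (s * (lam * x i ^ (k - 1))) := by gcongr
    _ = lam * |x i| ^ k := by rw [h2, ← hs]; ring

theorem aux_min (k n : ℕ) (hk : 2 ≤ k) (hn : 1 ≤ n) (A : (Fin k → Fin n) → ℝ) :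
    ∃ y : Fin n → ℝ, (∀ i, 0 ≤ y i) ∧ ∑ i : Fin n, y i ^ k = 1 ∧
      ∀ x : Fin n → ℝ, (∀ i, 0 ≤ x i) → ∑ i : Fin n, x i ^ k = 1 →
        tApply k n A y ≤ tApply k n A x := by
  let S : Set (Fin n → ℝ) := {x | (∀ i, 0 ≤ x i) ∧ ∑ i : Fin n, x i ^ k = 1}
  have hS : IsCompact S := by
    refine IsCompact.of_isClosed_subset (isCompact_Icc (a := (0 : Fin n → ℝ)) (b := 1)) ?_ ?_
    · refine IsClosed.inter ?_ ?_
      · have e : {x : Fin n → ℝ | ∀ i, 0 ≤ x i} = ⋂ i, {x | 0 ≤ x i} := by ext x; simp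
        change IsClosed {x : Fin n → ℝ | ∀ i, 0 ≤ x i}
        rw [e]
        exact isClosed_iInter fun i => isClosed_le continuous_const (continuous_apply i)
      · exact isClosed_eq (by fun_prop) continuous_const
    · rintro x ⟨hx, h1⟩
      refine ⟨fun i => hx i, fun i => ?_⟩
      have : x i ^ k ≤ 1 := by
        rw [← h1]
        exact Finset.single_le_sum (f := fun i => x i ^ k)
          (fun i _ => pow_nonneg (hx i) k) (Finset.mem_univ i)
      exact (pow_le_one_iff_of_nonneg (hx i) (by omega)).1 this
  have hne : S.Nonempty := by
    refine ⟨fun l => if l = ⟨0, by omega⟩ then 1 else 0, fun i => ?_, ?_⟩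
    · dsimp only; split_ifs <;> simp
    · simp [ite_pow, zero_pow (show k ≠ 0 by omega)]
  have hcont : Continuous (tApply k n A) := by unfold tApply; fun_prop
  obtain ⟨y, hy, hmin⟩ := hS.exists_isMinOn hne hcont.continuousOn
  exact ⟨y, hy.1, hy.2, fun x h1 h2 => hmin ⟨h1, h2⟩⟩

/-- minimum property of the least H-eigenvalue of a symmetric,
essentially nonpositive tensor. -/
theorem min_heigenvalue_of_symm_ess_nonpos (k n : ℕ) (hk : 2 ≤ k) (hn : 1 ≤ n)
    (A : (Fin k → Fin n) → ℝ) (hsym : IsSymmTensor k n A)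
    (hess : ∀ f : Fin k → Fin n, (¬ ∃ i : Fin n, ∀ j : Fin k, f j = i) → A f ≤ 0)
    (lam : ℝ) (hlam : IsHEigenvalue k n hk A lam)
    (hmin : ∀ mu : ℝ, IsHEigenvalue k n hk A mu → lam ≤ mu) :
    (∀ x : Fin n → ℝ, (∀ i, 0 ≤ x i) → ∑ i : Fin n, x i ^ k = 1 →
      lam ≤ tApply k n A x) ∧
    ∃ y : Fin n → ℝ, (∀ i, 0 ≤ y i) ∧ ∑ i : Fin n, y i ^ k = 1 ∧
      tApply k n A y = lam := by
  obtain ⟨y, hy, hy1, hmy⟩ := aux_min k n hk hn A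
  have hh := aux_homog k n hk A _ hmy
  have heq : lam = tApply k n A y := by
    apply le_antisymm
    · refine hmin _ ⟨y, ?_, aux_eig k n hk A hsym hess _ hh y hy (by rw [hy1, mul_one])⟩
      rintro rfl
      simp [zero_pow (show k ≠ 0 by omega)] at hy1
    · obtain ⟨x, hx0, hx⟩ := hlam
      have h1 := aux_lower k n hk A hess lam x hx
      have h2 := hh (fun i => |x i|) (fun i => abs_nonneg _)
      have hpos : 0 < ∑ i, |x i| ^ k := by
        obtain ⟨i, hi⟩ := Function.ne_iff.1 hx0
        exact Finset.sum_pos' (fun i _ => by positivity)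
          ⟨i, Finset.mem_univ i, pow_pos (abs_pos.2 hi) k⟩
      exact le_of_mul_le_mul_right (h2.trans h1) hpos
  subst heq
  exact ⟨hmy, y, hy, hy1, rfl⟩
end

section
/- Let B be a real symmetric tensor of order k and dimension n. Suppose that for each i = 1,…,n, the diagonal entry plus the sum of all negative off-diagonal entries in the i-th row is nonnegative, i.e., b_{i…i} + ∑_{(i₂,…,i_k) ≠ (i,…,i)} min(b_{i i₂…i_k}, 0) ≥ 0. Then B is copositive. -/
open Finset

theorem amgm_aux (k : ℕ) (hk : k ≠ 0) (y : Fin k → ℝ) (hy : ∀ j, 0 ≤ y j) :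
    ∏ j, y j ≤ ∑ j, (k : ℝ)⁻¹ * y j ^ k := by
  have h := Real.geom_mean_le_arith_mean_weighted (Finset.univ : Finset (Fin k))
    (fun _ => (k : ℝ)⁻¹) (fun j => y j ^ k) (fun _ _ => by positivity)
    (by simp [hk]) (fun j _ => pow_nonneg (hy j) k)
  have e : ∀ j, (y j ^ k) ^ ((k : ℝ)⁻¹) = y j := fun j => Real.pow_rpow_inv_natCast (hy j) hk
  simpa only [e] using h

/-- a nonnegative diagonal dominated symmetric tensor is copositive. -/
theorem copositive_of_diag_dominated (k n : ℕ) (hk : 2 ≤ k) (hn : 1 ≤ n)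
    (B : (Fin k → Fin n) → ℝ) (hsym : IsSymmTensor k n B)
    (hdom : ∀ i : Fin n,
      0 ≤ B (fun _ => i) +
        ∑ f ∈ Finset.univ.filter
          (fun f : Fin k → Fin n => f ⟨0, by omega⟩ = i ∧ f ≠ (fun _ => i)),
          min (B f) 0) :
    ∀ x : Fin n → ℝ, (∀ i, 0 ≤ x i) → 0 ≤ tApply k n B x := by
  intro x hx
  have hk0 : k ≠ 0 := by omega
  have hkR : (k : ℝ) ≠ 0 := by exact_mod_cast hk0
  set z : Fin k := ⟨0, by omega⟩ with hz
  classical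
  let C : (Fin k → Fin n) → ℝ := fun f => if f = (fun _ => f z) then B f else min (B f) 0
  have hconst : ∀ (σ : Equiv.Perm (Fin k)) (f : Fin k → Fin n),
      f = (fun _ => f z) → f ∘ σ = (fun _ => (f ∘ σ) z) := by
    intro σ f h
    funext j
    have h1 := congrFun h (σ j)
    have h2 := congrFun h (σ z)
    simp only [Function.comp] at *
    rw [h1, h2]
  have hC : ∀ (σ : Equiv.Perm (Fin k)) (f : Fin k → Fin n), C (f ∘ σ) = C f := by
    intro σ f
    have hiff : (f ∘ σ = (fun _ => (f ∘ σ) z)) ↔ (f = (fun _ => f z)) := by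
      refine ⟨fun h => ?_, hconst σ f⟩
      have h3 := hconst σ⁻¹ (f ∘ σ) h
      have h4 : (f ∘ σ) ∘ (σ⁻¹ : Equiv.Perm (Fin k)) = f := by
        funext j; simp
      rw [h4] at h3
      exact h3
    simp only [C, hiff, hsym σ f]
  have hrow : ∀ i : Fin n, 0 ≤ ∑ f with f z = i, C f := by
    intro i
    have hmem : (fun _ => i : Fin k → Fin n) ∈ Finset.univ.filter (fun f : Fin k → Fin n => f z = i) := by
      simp
    rw [← Finset.add_sum_erase _ _ hmem]
    have := hdom i
    refine this.trans (le_of_eq ?_)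
    congr 1
    · simp [C]
    · refine Finset.sum_congr ?_ ?_
      · ext f; simp [and_comm]
      · intro f hf
        simp only [Finset.mem_erase, Finset.mem_filter, Finset.mem_univ, true_and] at hf
        have : ¬ (f = (fun _ => f z)) := by
          rw [hf.2]; exact hf.1
        simp only [C, if_neg this]
  have hterm : ∀ f : Fin k → Fin n,
      ∑ j, (k : ℝ)⁻¹ * (C f * x (f j) ^ k) ≤ B f * ∏ j, x (f j) := by
    intro f
    have hp : 0 ≤ ∏ j, x (f j) := Finset.prod_nonneg fun j _ => hx _
    have hs : ∑ j, (k : ℝ)⁻¹ * (C f * x (f j) ^ k)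
        = C f * ∑ j, (k : ℝ)⁻¹ * x (f j) ^ k := by
      rw [Finset.mul_sum]; exact Finset.sum_congr rfl fun j _ => by ring
    rw [hs]
    by_cases h : f = (fun _ => f z)
    · have hCf : C f = B f := by simp only [C, if_pos h]
      have h' : ∀ j, f j = f z := fun j => congrFun h j
      rw [hCf]
      simp only [h']
      simp [hkR]
    · have hCf : C f = min (B f) 0 := by simp only [C, if_neg h]
      rw [hCf]
      calc _ ≤ min (B f) 0 * ∏ j, x (f j) :=
            mul_le_mul_of_nonpos_left (amgm_aux k hk0 _ fun j => hx _) (min_le_right _ _)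
        _ ≤ _ := mul_le_mul_of_nonneg_right (min_le_left _ _) hp
  have hz0 : 0 ≤ ∑ f : Fin k → Fin n, C f * x (f z) ^ k := by
    rw [← Finset.sum_fiberwise Finset.univ (fun f : Fin k → Fin n => f z)]
    refine Finset.sum_nonneg fun i _ => ?_
    have : ∑ f with f z = i, C f * x (f z) ^ k = (∑ f with f z = i, C f) * x i ^ k := by
      rw [Finset.sum_mul]
      refine Finset.sum_congr rfl fun f hf => ?_
      rw [(Finset.mem_filter.1 hf).2]
    rw [this]
    exact mul_nonneg (hrow i) (pow_nonneg (hx i) k)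
  have hj : ∀ j : Fin k, ∑ f : Fin k → Fin n, C f * x (f j) ^ k
      = ∑ f : Fin k → Fin n, C f * x (f z) ^ k := by
    intro j
    refine Fintype.sum_equiv (Equiv.arrowCongr (Equiv.swap z j) (Equiv.refl (Fin n))) _ _ ?_
    intro f
    have e : (Equiv.arrowCongr (Equiv.swap z j) (Equiv.refl (Fin n))) f
        = f ∘ (Equiv.swap z j : Equiv.Perm (Fin k)) := by
      funext a; simp [Equiv.arrowCongr]
    rw [e, hC]
    simp
  unfold tApply
  refine le_trans ?_ (Finset.sum_le_sum fun f _ => hterm f)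
  rw [Finset.sum_comm]
  refine Finset.sum_nonneg fun j _ => ?_
  rw [← Finset.mul_sum, hj j]
  exact mul_nonneg (by positivity) hz0
end
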